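/- There are no positive integers n1, n2 and a such that α^{n1} + α^{n2} = 2^a · √5. -/

import Mathlib

/-- There are no positive integers `n1`, `n2` and `a` with
`α^{n1} + α^{n2} = 2^a·√5`, where `α = (1+√5)/2`. -/
theorem no_sum_of_two_powers_of_alpha_eq_power_of_two_mul_sqrt_five :
    ¬ ∃ (n1 n2 a : ℕ), 0 < n1 ∧ 0 < n2 ∧ 0 < a ∧
      ((1 + Real.sqrt 5) / 2) ^ n1 + ((1 + Real.sqrt 5) / 2) ^ n2 =
        (2 : ℝ) ^ a * Real.sqrt 5 := by
  rintro ⟨n, m, a, hn, hm, -, h⟩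
  have h1 := Real.fib_succ_sub_goldenConj_mul_fib n
  have h2 := Real.fib_succ_sub_goldenConj_mul_fib m
  unfold Real.goldenRatio Real.goldenConj at h1 h2
  rw [← h1, ← h2] at h
  have p1 : (0 : ℝ) < Nat.fib n := by exact_mod_cast Nat.fib_pos.2 hn
  have p2 : (0 : ℝ) < Nat.fib m := by exact_mod_cast Nat.fib_pos.2 hm
  have q1 : (Nat.fib n : ℝ) ≤ Nat.fib (n + 1) := by exact_mod_cast Nat.fib_le_fib_succ
  have q2 : (Nat.fib m : ℝ) ≤ Nat.fib (m + 1) := by exact_mod_cast Nat.fib_le_fib_succ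
  have key : (2 * (Nat.fib (n + 1) + Nat.fib (m + 1)) - (Nat.fib n + Nat.fib m) : ℝ)
      = (2 * 2 ^ a - (Nat.fib n + Nat.fib m)) * Real.sqrt 5 := by linarith
  have hd : (2 * 2 ^ a - (Nat.fib n + Nat.fib m) : ℝ) ≠ 0 := by
    intro h0
    rw [h0] at key
    linarith
  have irr : Irrational (Real.sqrt 5) := by
    simpa using Nat.Prime.irrational_sqrt (show Nat.Prime 5 by norm_num)
  apply irr
  refine ⟨(2 * (Nat.fib (n + 1) + Nat.fib (m + 1)) - (Nat.fib n + Nat.fib m)) /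
    (2 * 2 ^ a - (Nat.fib n + Nat.fib m)), ?_⟩
  push_cast
  rw [key]
  field_simp
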